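/- Let F be a discrete isothermic net with cross ratio factorizing function a, let μ₀, …, μ_N ∈ ℝ be pairwise distinct with μₙ·a_{ij} ≠ 1 on all edges, and let F̂⁰, …, F̂ᴺ : M → ℝ^5 satisfy F̂ⁿ_i = Γ^{μₙ}_{ij}(F̂ⁿ_j) on every edge (ij). Suppose there are constants α₀, …, α_N ∈ ℝ such that Z_i := Σ_{n=0}^{N} αₙ·F̂ⁿ_i satisfies ⟨Z_i, F_i⟩ = 0 at every vertex i. Then P_i(λ) := Σ_{n=0}^{N} αₙ·F̂ⁿ_i·∏_{m≠n}(λ−μ_m) is a polynomial conserved quantity of F of degree ≤ N with top coefficient Z; and if ⟨Z_i,Z_i⟩ = 1 at some vertex i, then ⟨Z,Z⟩ ≡ 1 on M, i.e. P is a normalized polynomial conserved quantity of degree N. -/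

import Mathlib

noncomputable section

/-- The Minkowski bilinear form of signature (4,1) on `ℝ^5`. -/
def mink (x y : Fin 5 → ℝ) : ℝ :=
  -(x 0 * y 0) + x 1 * y 1 + x 2 * y 2 + x 3 * y 3 + x 4 * y 4

/-- The light cone `L⁴ ⊂ ℝ^{4,1}`. -/
def LightCone (x : Fin 5 → ℝ) : Prop :=
  x ≠ 0 ∧ mink x x = 0

/-- The map `Γ^q_{p,p'}` of the paper. -/
def Gamma (p p' : Fin 5 → ℝ) (q : ℝ) (X : Fin 5 → ℝ) : Fin 5 → ℝ :=
  X + (1 / mink p p') •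
    (((q - 1) * mink X p') • p + ((1 / q - 1) * mink X p) • p')

/-- Two vectors are proportional if one is a scalar multiple of the other. -/
def Proportional (x y : Fin 5 → ℝ) : Prop :=
  (∃ t : ℝ, y = t • x) ∨ (∃ t : ℝ, x = t • y)

/-- Membership in the rectangular grid `M`. -/
def InGrid (m₁ m₂ n₁ n₂ : ℤ) (i : ℤ × ℤ) : Prop :=
  m₁ ≤ i.1 ∧ i.1 ≤ m₂ ∧ n₁ ≤ i.2 ∧ i.2 ≤ n₂

/-- `(i,j)` is an edge of the grid (in either orientation). -/
def IsEdge (m₁ m₂ n₁ n₂ : ℤ) (i j : ℤ × ℤ) : Prop :=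
  InGrid m₁ m₂ n₁ n₂ i ∧ InGrid m₁ m₂ n₁ n₂ j ∧
    ((j.1 = i.1 + 1 ∧ j.2 = i.2) ∨ (i.1 = j.1 + 1 ∧ i.2 = j.2) ∨
     (j.1 = i.1 ∧ j.2 = i.2 + 1) ∨ (i.1 = j.1 ∧ i.2 = j.2 + 1))

/-- `(i,j,k,l)` is an elementary quadrilateral (face) of the grid. -/
def IsFace (m₁ m₂ n₁ n₂ : ℤ) (i j k l : ℤ × ℤ) : Prop :=
  InGrid m₁ m₂ n₁ n₂ i ∧ InGrid m₁ m₂ n₁ n₂ k ∧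
    j = (i.1 + 1, i.2) ∧ k = (i.1 + 1, i.2 + 1) ∧ l = (i.1, i.2 + 1)

/-- Four vectors are pairwise non-proportional. -/
def FaceRegular (v w x y : Fin 5 → ℝ) : Prop :=
  ¬ Proportional v w ∧ ¬ Proportional v x ∧ ¬ Proportional v y ∧
  ¬ Proportional w x ∧ ¬ Proportional w y ∧ ¬ Proportional x y

/-- A discrete isothermic net (with values in the light cone) with cross ratio
factorizing function `a`. -/
structure IsIsothermic (m₁ m₂ n₁ n₂ : ℤ) (F : ℤ × ℤ → Fin 5 → ℝ)
    (a : ℤ × ℤ → ℤ × ℤ → ℝ) : Prop where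
  lightcone : ∀ i, InGrid m₁ m₂ n₁ n₂ i → LightCone (F i)
  regular : ∀ i j k l, IsFace m₁ m₂ n₁ n₂ i j k l →
    FaceRegular (F i) (F j) (F k) (F l)
  symm : ∀ i j, IsEdge m₁ m₂ n₁ n₂ i j → a i j = a j i
  nonzero : ∀ i j, IsEdge m₁ m₂ n₁ n₂ i j → a i j ≠ 0
  opposite : ∀ i j k l, IsFace m₁ m₂ n₁ n₂ i j k l →
    a i j = a l k ∧ a i l = a j k
  cross : ∀ i j k l, IsFace m₁ m₂ n₁ n₂ i j k l →
    ∃ t : ℝ, t ≠ 0 ∧ F k = t • Gamma (F j) (F l) (a i j / a i l) (F i)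

/-- Evaluation of the polynomial with vector coefficients `P i 0, …, P i N`
at the spectral parameter `lam`. -/
def pcqEval (N : ℕ) (P : ℤ × ℤ → ℕ → Fin 5 → ℝ) (i : ℤ × ℤ) (lam : ℝ) :
    Fin 5 → ℝ :=
  ∑ k ∈ Finset.range (N + 1), lam ^ k • P i k

/-- `P` is a polynomial conserved quantity of degree at most `N` of the net `F`
with cross ratio factorizing function `a`. -/
def IsPCQ (m₁ m₂ n₁ n₂ : ℤ) (F : ℤ × ℤ → Fin 5 → ℝ) (a : ℤ × ℤ → ℤ × ℤ → ℝ)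
    (N : ℕ) (P : ℤ × ℤ → ℕ → Fin 5 → ℝ) : Prop :=
  ∀ i j, IsEdge m₁ m₂ n₁ n₂ i j → ∀ lam : ℝ, lam * a i j ≠ 1 →
    pcqEval N P i lam = Gamma (F i) (F j) (1 - lam * a i j) (pcqEval N P j lam)

/-- A polynomial conserved quantity is normalized (of degree `N`) if its top
coefficient has Minkowski square norm one at every vertex. -/
def Normalized (m₁ m₂ n₁ n₂ : ℤ) (N : ℕ) (P : ℤ × ℤ → ℕ → Fin 5 → ℝ) : Prop :=
  ∀ i, InGrid m₁ m₂ n₁ n₂ i → mink (P i N) (P i N) = 1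

/-- A Darboux transform of `F` with parameter `μ`. -/
def IsDarboux (m₁ m₂ n₁ n₂ : ℤ) (F : ℤ × ℤ → Fin 5 → ℝ) (a : ℤ × ℤ → ℤ × ℤ → ℝ)
    (μ : ℝ) (Fh : ℤ × ℤ → Fin 5 → ℝ) : Prop :=
  (∀ i, InGrid m₁ m₂ n₁ n₂ i → LightCone (Fh i)) ∧
  (∀ i, InGrid m₁ m₂ n₁ n₂ i → ¬ Proportional (F i) (Fh i)) ∧
  (∀ i j, IsEdge m₁ m₂ n₁ n₂ i j → Fh i = Gamma (F i) (F j) (1 - μ * a i j) (Fh j))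

/-- A Calapso transformation of `F` at parameter `μ`: a vertexwise family of
linear isometries of `ℝ^{4,1}` gauging the isothermic connection at `μ` to the
trivial connection. -/
def IsCalapso (m₁ m₂ n₁ n₂ : ℤ) (F : ℤ × ℤ → Fin 5 → ℝ) (a : ℤ × ℤ → ℤ × ℤ → ℝ)
    (μ : ℝ) (T : ℤ × ℤ → (Fin 5 → ℝ) → (Fin 5 → ℝ)) : Prop :=
  (∀ i, InGrid m₁ m₂ n₁ n₂ i → IsLinearMap ℝ (T i)) ∧
  (∀ i, InGrid m₁ m₂ n₁ n₂ i → ∀ x y, mink (T i x) (T i y) = mink x y) ∧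
  (∀ i j, IsEdge m₁ m₂ n₁ n₂ i j → ∀ x,
    T j x = T i (Gamma (F i) (F j) (1 - μ * a i j) x))

theorem mink_sum {ι : Type*} (s : Finset ι) (c : ι → ℝ) (X : ι → Fin 5 → ℝ) (p : Fin 5 → ℝ) :
    mink (∑ n ∈ s, c n • X n) p = ∑ n ∈ s, c n * mink (X n) p := by
  classical
  induction s using Finset.induction_on with
  | empty => simp [mink]
  | insert x s hx ih =>
    rw [Finset.sum_insert hx, Finset.sum_insert hx, ← ih]
    simp only [mink, Pi.add_apply, Pi.smul_apply, smul_eq_mul]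
    ring

theorem mink_add_smul (x y z : Fin 5 → ℝ) (A B : ℝ) (p : Fin 5 → ℝ) :
    mink (x + A • y + B • z) p = mink x p + A * mink y p + B * mink z p := by
  simp only [mink, Pi.add_apply, Pi.smul_apply, smul_eq_mul]
  ring

theorem mink_comm' (x y : Fin 5 → ℝ) : mink x y = mink y x := by
  simp only [mink]
  ring

theorem Gamma_eq (p p' : Fin 5 → ℝ) (q : ℝ) (X : Fin 5 → ℝ) :
    Gamma p p' q X = X + ((q - 1) * mink X p' / mink p p') • p
      + ((1 / q - 1) * mink X p / mink p p') • p' := by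
  ext k
  simp only [Gamma, Pi.add_apply, Pi.smul_apply, smul_eq_mul]
  ring

theorem sum_Gamma {ι : Type*} [Fintype ι] (p p' : Fin 5 → ℝ) (c q : ι → ℝ)
    (X : ι → Fin 5 → ℝ) :
    ∑ n, c n • Gamma p p' (q n) (X n) = (∑ n, c n • X n)
      + (∑ n, c n * ((q n - 1) * mink (X n) p' / mink p p')) • p
      + (∑ n, c n * ((1 / q n - 1) * mink (X n) p / mink p p')) • p' := by
  simp only [Gamma_eq, smul_add, smul_smul, Finset.sum_add_distrib, Finset.sum_smul]

theorem edge_norm {ι : Type*} [Fintype ι] (p p' : Fin 5 → ℝ) (hp : mink p p = 0)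
    (hp' : mink p' p' = 0) (c q : ι → ℝ) (X : ι → Fin 5 → ℝ)
    (h1 : mink (∑ n, c n • X n) p' = 0)
    (h2 : mink (∑ n, c n • Gamma p p' (q n) (X n)) p = 0) :
    mink (∑ n, c n • Gamma p p' (q n) (X n)) (∑ n, c n • Gamma p p' (q n) (X n)) =
      mink (∑ n, c n • X n) (∑ n, c n • X n) := by
  by_cases h0 : mink p p' = 0
  · simp [sum_Gamma, h0]
  rw [sum_Gamma] at h2 ⊢
  generalize (∑ n, c n * ((q n - 1) * mink (X n) p' / mink p p')) = A at *
  generalize (∑ n, c n * ((1 / q n - 1) * mink (X n) p / mink p p')) = B at *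
  generalize (∑ n, c n • X n) = Z at *
  rw [mink_add_smul] at h2
  rw [mink_add_smul, mink_comm' Z, mink_comm' p, mink_comm' p', mink_add_smul, mink_add_smul,
    mink_add_smul, h1, hp, hp', mink_comm' p Z, mink_comm' p' Z, h1]
  rw [hp, mink_comm' p' p] at h2
  rw [mink_comm' p' p]
  linear_combination 2 * A * h2

theorem edge_pcq {N : ℕ} (p p' : Fin 5 → ℝ) (hp : mink p p = 0)
    (α μ : Fin (N + 1) → ℝ) (a lam : ℝ) (hl : lam * a ≠ 1) (hadm : ∀ n, μ n * a ≠ 1)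
    (X : Fin (N + 1) → Fin 5 → ℝ)
    (h1 : mink (∑ n, α n • X n) p' = 0)
    (h2 : mink (∑ n, α n • Gamma p p' (1 - μ n * a) (X n)) p = 0) :
    (∑ n, (α n * ∏ m ∈ Finset.univ.erase n, (lam - μ m)) • Gamma p p' (1 - μ n * a) (X n)) =
      Gamma p p' (1 - lam * a)
        (∑ n, (α n * ∏ m ∈ Finset.univ.erase n, (lam - μ m)) • X n) := by
  by_cases h0 : mink p p' = 0
  · simp [Gamma_eq, h0]
  have hq : ∀ n, 1 - μ n * a ≠ 0 := fun n => sub_ne_zero.2 (Ne.symm (hadm n))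
  have hq' : 1 - lam * a ≠ 0 := sub_ne_zero.2 (Ne.symm hl)
  have hprod : ∀ n, (∏ m ∈ Finset.univ.erase n, (lam - μ m)) * (lam - μ n) =
      ∏ m, (lam - μ m) := fun n => Finset.prod_erase_mul _ _ (Finset.mem_univ n)
  have h2' : ∑ n, α n * (mink (X n) p / (1 - μ n * a)) = 0 := by
    rw [mink_sum] at h2
    rw [← h2]
    refine Finset.sum_congr rfl fun n _ => ?_
    rw [Gamma_eq, mink_add_smul, hp, mink_comm' p' p]
    field_simp
    ring
  rw [mink_sum] at h1
  rw [sum_Gamma, Gamma_eq, mink_sum, mink_sum]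
  congr 2
  · congr 1
    rw [Finset.mul_sum, Finset.sum_div, ← sub_eq_zero, ← Finset.sum_sub_distrib]
    rw [← mul_zero (a * (∏ m, (lam - μ m)) / mink p p'), ← h1, Finset.mul_sum]
    refine Finset.sum_congr rfl fun n _ => ?_
    rw [← hprod n]
    ring
  · rw [Finset.mul_sum, Finset.sum_div, ← sub_eq_zero, ← Finset.sum_sub_distrib]
    rw [← mul_zero (-a * (∏ m, (lam - μ m)) / mink p p' / (1 - lam * a)), ← h2', Finset.mul_sum]
    refine Finset.sum_congr rfl fun n _ => ?_
    rw [← hprod n]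
    have := hq n
    field_simp
    ring

theorem grid_const (m₁ m₂ n₁ n₂ : ℤ) (f : ℤ × ℤ → ℝ)
    (h : ∀ i j, IsEdge m₁ m₂ n₁ n₂ i j → f i = f j) (i : ℤ × ℤ)
    (hi : InGrid m₁ m₂ n₁ n₂ i) : f i = f (m₁, n₁) := by
  obtain ⟨x, y⟩ := i
  obtain ⟨h1, h2, h3, h4⟩ := hi
  simp only at h1 h2 h3 h4
  have A : ∀ z, m₁ ≤ z → z ≤ m₂ → f (z, n₁) = f (m₁, n₁) := by
    intro z hz
    induction z, hz using Int.leInduction with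
    | base => intro _; rfl
    | succ z hz ih =>
      intro hz'
      rw [← ih (by omega)]
      apply h
      refine ⟨⟨?_, ?_, ?_, ?_⟩, ⟨?_, ?_, ?_, ?_⟩, Or.inr (Or.inl ⟨rfl, rfl⟩)⟩ <;> dsimp only <;> omega
  have B : ∀ z, n₁ ≤ z → z ≤ n₂ → f (x, z) = f (x, n₁) := by
    intro z hz
    induction z, hz using Int.leInduction with
    | base => intro _; rfl
    | succ z hz ih =>
      intro hz'
      rw [← ih (by omega)]
      apply h
      refine ⟨⟨?_, ?_, ?_, ?_⟩, ⟨?_, ?_, ?_, ?_⟩, Or.inr (Or.inr (Or.inr ⟨rfl, rfl⟩))⟩ <;> dsimp only <;> omega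
  rw [B y h3 h4, A x h1 h2]

/-- reconstruction of a polynomial conserved quantity from
`N+1` parallel sections of the connections `Γ^{μ_n}` whose constant linear
combination `Z` is incident with the net. -/
theorem statement15 (m₁ m₂ n₁ n₂ : ℤ) (F : ℤ × ℤ → Fin 5 → ℝ)
    (a : ℤ × ℤ → ℤ × ℤ → ℝ) (N : ℕ)
    (hiso : IsIsothermic m₁ m₂ n₁ n₂ F a)
    (μ : Fin (N + 1) → ℝ) (hdist : Function.Injective μ)
    (hadm : ∀ n : Fin (N + 1), ∀ i j, IsEdge m₁ m₂ n₁ n₂ i j → μ n * a i j ≠ 1)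
    (Fh : Fin (N + 1) → ℤ × ℤ → Fin 5 → ℝ)
    (hpar : ∀ n : Fin (N + 1), ∀ i j, IsEdge m₁ m₂ n₁ n₂ i j →
      Fh n i = Gamma (F i) (F j) (1 - μ n * a i j) (Fh n j))
    (α : Fin (N + 1) → ℝ)
    (hZ : ∀ i, InGrid m₁ m₂ n₁ n₂ i →
      mink (∑ n : Fin (N + 1), α n • Fh n i) (F i) = 0) :
    (∃ C : ℤ × ℤ → ℕ → Fin 5 → ℝ,
      IsPCQ m₁ m₂ n₁ n₂ F a N C ∧
      (∀ i, InGrid m₁ m₂ n₁ n₂ i → ∀ lam : ℝ,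
        pcqEval N C i lam
          = ∑ n : Fin (N + 1),
              (α n * ∏ m ∈ Finset.univ.erase n, (lam - μ m)) • Fh n i) ∧
      (∀ i, InGrid m₁ m₂ n₁ n₂ i → C i N = ∑ n : Fin (N + 1), α n • Fh n i)) ∧
    ((∃ i₀, InGrid m₁ m₂ n₁ n₂ i₀ ∧
        mink (∑ n : Fin (N + 1), α n • Fh n i₀)
          (∑ n : Fin (N + 1), α n • Fh n i₀) = 1) →
      ∀ i, InGrid m₁ m₂ n₁ n₂ i →
        mink (∑ n : Fin (N + 1), α n • Fh n i)
          (∑ n : Fin (N + 1), α n • Fh n i) = 1) := by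
  classical
  set π : Fin (N + 1) → Polynomial ℝ := fun n =>
    ∏ m ∈ Finset.univ.erase n, (Polynomial.X - Polynomial.C (μ m)) with hπ
  have hmonic : ∀ n, (π n).Monic := fun n =>
    Polynomial.monic_prod_of_monic _ _ fun m _ => Polynomial.monic_X_sub_C _
  have hdeg : ∀ n, (π n).natDegree = N := by
    intro n
    rw [hπ]
    simp only
    rw [Polynomial.natDegree_prod_of_monic _ _ fun m _ => Polynomial.monic_X_sub_C _]
    simp
  have heval : ∀ n lam, (π n).eval lam = ∏ m ∈ Finset.univ.erase n, (lam - μ m) := by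
    intro n lam
    simp [hπ, Polynomial.eval_prod]
  set C : ℤ × ℤ → ℕ → Fin 5 → ℝ := fun i k =>
    ∑ n, (α n * (π n).coeff k) • Fh n i with hC
  have hCe : ∀ i lam, pcqEval N C i lam = ∑ n : Fin (N + 1),
      (α n * ∏ m ∈ Finset.univ.erase n, (lam - μ m)) • Fh n i := by
    intro i lam
    simp only [pcqEval, hC, Finset.smul_sum]
    rw [Finset.sum_comm]
    refine Finset.sum_congr rfl fun n _ => ?_
    rw [← heval, Polynomial.eval_eq_sum_range, hdeg, Finset.mul_sum, Finset.sum_smul]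
    refine Finset.sum_congr rfl fun k _ => ?_
    rw [smul_smul]
    congr 1
    ring
  have hZi : ∀ i j, IsEdge m₁ m₂ n₁ n₂ i j →
      (∑ n : Fin (N + 1), α n • Fh n i) =
        ∑ n, α n • Gamma (F i) (F j) (1 - μ n * a i j) (Fh n j) := fun i j hij =>
    Finset.sum_congr rfl fun n _ => by rw [← hpar n i j hij]
  refine ⟨⟨C, ?_, fun i _ lam => hCe i lam, ?_⟩, ?_⟩
  · intro i j hij lam hl
    rw [hCe, hCe, ← edge_pcq (F i) (F j) (hiso.lightcone i hij.1).2 α μ (a i j) lam hl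
      (fun n => hadm n i j hij) (fun n => Fh n j) (hZ j hij.2.1)
      (by rw [← hZi i j hij]; exact hZ i hij.1)]
    exact Finset.sum_congr rfl fun n _ => by rw [← hpar n i j hij]
  · intro i _
    refine Finset.sum_congr rfl fun n _ => ?_
    have : (π n).coeff N = 1 := by
      have := (hmonic n).coeff_natDegree
      rwa [hdeg] at this
    rw [this, mul_one]
  · rintro ⟨i₀, hi₀, h1⟩ i hi
    have key : ∀ i j, IsEdge m₁ m₂ n₁ n₂ i j →
        mink (∑ n : Fin (N + 1), α n • Fh n i) (∑ n : Fin (N + 1), α n • Fh n i) =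
        mink (∑ n : Fin (N + 1), α n • Fh n j) (∑ n : Fin (N + 1), α n • Fh n j) := by
      intro i j hij
      rw [hZi i j hij]
      exact edge_norm (F i) (F j) (hiso.lightcone i hij.1).2 (hiso.lightcone j hij.2.1).2
        α (fun n => 1 - μ n * a i j) (fun n => Fh n j) (hZ j hij.2.1)
        (by rw [← hZi i j hij]; exact hZ i hij.1)
    have g := grid_const m₁ m₂ n₁ n₂
      (fun i => mink (∑ n : Fin (N + 1), α n • Fh n i) (∑ n : Fin (N + 1), α n • Fh n i)) key
    have e1 := g i hi
    have e2 := g i₀ hi₀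
    rw [e1, ← e2, h1]
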